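/- Let K ⊆ ℝⁿ be a convex body. Then W(K − K) ≤ (C(2n,n) / 2^{n/2}) · W(√2·K), where K − K = K + (−K) is the difference body of K and C(2n,n) is the central binomial coefficient. -/

import Mathlib

open scoped Pointwise
open MeasureTheory Metric Real

/-- The Wills functional `W(K) = ∫_{ℝⁿ} e^{-π d(x,K)²} dx`. -/
noncomputable def wills {n : ℕ} (K : Set (EuclideanSpace ℝ (Fin n))) : ℝ :=
  ∫ x, Real.exp (-π * (Metric.infDist x K) ^ 2)

theorem beta_nat (b : ℕ) : ∀ a : ℕ, ∫ s in (0:ℝ)..1, s ^ a * (1 - s) ^ b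
    = (a.factorial * b.factorial : ℝ) / ((a + b + 1).factorial : ℝ) := by
  induction b with
  | zero =>
    intro a
    have := Nat.factorial_ne_zero a
    simp [Nat.factorial_succ]
    field_simp
  | succ b ih =>
    intro a
    have h := intervalIntegral.integral_eq_sub_of_hasDerivAt (a := 0) (b := 1)
      (f := fun s : ℝ => s ^ (a+1) * (1 - s) ^ (b+1))
      (f' := fun s : ℝ => (a+1) * (s ^ a * (1 - s) ^ (b+1)) - (b+1) * (s ^ (a+1) * (1 - s) ^ b))
      (by
        intro s _
        have h1 := (hasDerivAt_pow (a+1) s).mul (((hasDerivAt_id s).const_sub 1).pow (b+1))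
        convert! h1 using 1
        simp
        ring)
      (by apply Continuous.intervalIntegrable; fun_prop)
    rw [intervalIntegral.integral_sub (by apply Continuous.intervalIntegrable; fun_prop)
      (by apply Continuous.intervalIntegrable; fun_prop),
      intervalIntegral.integral_const_mul, intervalIntegral.integral_const_mul, ih (a+1)] at h
    simp at h
    have e : a + 1 + b + 1 = a + (b + 1) + 1 := by ring
    rw [e] at h
    have hp : ((a + (b+1) + 1).factorial : ℝ) ≠ 0 := by positivity
    have ha : (a : ℝ) + 1 ≠ 0 := by positivity
    rw [Nat.factorial_succ a] at h
    rw [Nat.factorial_succ b]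
    push_cast at h ⊢
    rw [sub_eq_zero] at h
    apply mul_left_cancel₀ ha
    rw [h]
    ring

theorem lint_poly (f : ℝ → ℝ) (hf : Continuous f) {a b : ℝ} (hab : a ≤ b)
    (h0 : ∀ s ∈ Set.Icc a b, 0 ≤ f s) :
    ∫⁻ s in Set.Ioc a b, ENNReal.ofReal (f s) = ENNReal.ofReal (∫ s in a..b, f s) := by
  rw [intervalIntegral.integral_of_le hab, ofReal_integral_eq_lintegral_ofReal]
  · exact (hf.continuousOn.integrableOn_Icc).mono_set Set.Ioc_subset_Icc_self
  · rw [Filter.EventuallyLE, ae_restrict_iff' measurableSet_Ioc]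
    exact Filter.Eventually.of_forall fun s hs => h0 s ⟨hs.1.le, hs.2⟩

theorem int_weight (m : ℕ) (c : ℝ) :
    ∫ s in c..1, ((m:ℝ) + 1) * (1 - s) ^ m = (1 - c) ^ (m+1) := by
  have h := intervalIntegral.integral_eq_sub_of_hasDerivAt (a := c) (b := 1)
      (f := fun s : ℝ => -(1 - s) ^ (m+1))
      (f' := fun s : ℝ => ((m:ℝ)+1) * (1 - s) ^ m)
      (by
        intro s _
        have h1 := (((hasDerivAt_id s).const_sub 1).pow (m+1)).neg
        convert! h1 using 1
        simp)
      (by apply Continuous.intervalIntegrable; fun_prop)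
  rw [h]; simp

/-- the weighted beta constant -/
theorem beta_const (m : ℕ) :
    ∫⁻ s in Set.Ioc (0:ℝ) 1, ENNReal.ofReal (((m:ℝ) + 1) * (1 - s) ^ m * s ^ (m+1))
      = ENNReal.ofReal (1 / ((2 * (m+1)).choose (m+1) : ℝ)) := by
  rw [lint_poly _ (by fun_prop) zero_le_one]
  · congr 1
    have : ∀ s : ℝ, ((m:ℝ) + 1) * (1 - s) ^ m * s ^ (m+1) = ((m:ℝ) + 1) * (s ^ (m+1) * (1 - s) ^ m) := by
      intro s; ring
    simp_rw [this]
    rw [intervalIntegral.integral_const_mul, beta_nat, Nat.cast_choose ℝ (by omega)]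
    rw [show m + 1 + m + 1 = 2 * (m+1) by ring, show 2 * (m+1) - (m+1) = m + 1 by omega]
    have : ((2 * (m+1)).factorial : ℝ) ≠ 0 := by positivity
    have : ((m+1).factorial : ℝ) ≠ 0 := by positivity
    have e : ((m+1).factorial : ℝ) = (m+1) * m.factorial := by rw [Nat.factorial_succ]; push_cast; ring
    have : (m.factorial : ℝ) ≠ 0 := by positivity
    rw [e]
    field_simp
  · intro s hs
    have : 0 ≤ 1 - s := by linarith [hs.2]
    have := hs.1
    positivity

theorem rs_lower {n : ℕ} {A : Set (EuclideanSpace ℝ (Fin n))} (hc : Convex ℝ A)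
    {s : ℝ} (hs0 : 0 ≤ s) (hs1 : s ≤ 1) {z : EuclideanSpace ℝ (Fin n)} (hz : z ∈ s • (A - A)) :
    ENNReal.ofReal ((1 - s) ^ n) * volume A ≤ volume {x | x ∈ A ∧ x - z ∈ A} := by
  obtain ⟨_, ⟨a, ha, b, hb, rfl⟩, rfl⟩ := hz
  have h := Measure.addHaar_image_homothety (volume : Measure (EuclideanSpace ℝ (Fin n))) a (1 - s) A
  rw [finrank_euclideanSpace_fin, abs_of_nonneg (pow_nonneg (by linarith) _)] at h
  rw [← h]
  apply measure_mono
  rintro _ ⟨x, hx, rfl⟩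
  simp only [AffineMap.homothety_apply, vsub_eq_sub, vadd_eq_add, Set.mem_ofPred_eq]
  constructor
  · have := hc hx ha (a := 1 - s) (b := s) (by linarith) hs0 (by ring)
    convert! this using 1
    module
  · have := hc hx hb (a := 1 - s) (b := s) (by linarith) hs0 (by ring)
    convert! this using 1
    module

theorem rs_pointwise {m : ℕ} {A : Set (EuclideanSpace ℝ (Fin (m+1)))} (hc : Convex ℝ A)
    (hA : volume A ≠ ⊤) (z : EuclideanSpace ℝ (Fin (m+1))) :
    ∫⁻ s in Set.Ioc (0:ℝ) 1, (ENNReal.ofReal (((m:ℝ) + 1) * (1 - s) ^ m) *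
      {p : EuclideanSpace ℝ (Fin (m+1)) × ℝ | p.2⁻¹ • p.1 ∈ A - A}.indicator 1 (z, s)) * volume A
      ≤ volume {x | x ∈ A ∧ x - z ∈ A} := by
  rw [lintegral_mul_const' _ _ hA]
  set T : Set ℝ := {s | s ∈ Set.Ioc (0:ℝ) 1 ∧ s⁻¹ • z ∈ A - A} with hT
  have hTg : ∀ s ∈ T, ENNReal.ofReal ((1 - s) ^ (m+1)) * volume A ≤ volume {x | x ∈ A ∧ x - z ∈ A} := by
    rintro s ⟨hs, hz⟩
    refine rs_lower hc hs.1.le hs.2 ?_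
    rwa [Set.mem_smul_set_iff_inv_smul_mem₀ hs.1.ne']
  rcases T.eq_empty_or_nonempty with hTe | hTn
  · rw [setLIntegral_congr_fun (g := 0) measurableSet_Ioc]
    · simp
    · intro s hs
      have : s ∉ T := by simp [hTe]
      have h2 : s⁻¹ • z ∉ A - A := fun h => this ⟨hs, h⟩
      simp [h2]
  · have hbdd : BddBelow T := ⟨0, fun s hs => hs.1.1.le⟩
    set c := sInf T with hcdef
    have hc0 : 0 ≤ c := le_csInf hTn fun s hs => hs.1.1.le
    have hc1 : c ≤ 1 := by
      obtain ⟨s, hs⟩ := hTn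
      exact (csInf_le hbdd hs).trans hs.1.2
    have key : ENNReal.ofReal ((1 - c) ^ (m+1)) * volume A ≤ volume {x | x ∈ A ∧ x - z ∈ A} := by
      obtain ⟨u, -, hu, huT⟩ := exists_seq_tendsto_sInf hTn hbdd
      have ht : Filter.Tendsto (fun k => ENNReal.ofReal ((1 - u k) ^ (m+1)) * volume A) Filter.atTop
          (nhds (ENNReal.ofReal ((1 - c) ^ (m+1)) * volume A)) := by
        apply ENNReal.Tendsto.mul_const _ (Or.inr hA)
        apply ENNReal.tendsto_ofReal
        exact (tendsto_const_nhds.sub hu).pow _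
      exact le_of_tendsto' ht fun k => hTg _ (huT k)
    refine le_trans (mul_le_mul_left ?_ _) key
    rw [← int_weight, ← lint_poly _ (by fun_prop) hc1]
    · rw [← lintegral_indicator measurableSet_Ioc, ← lintegral_indicator measurableSet_Ioc]
      apply lintegral_mono_ae
      filter_upwards [compl_mem_ae_iff.2 (measure_singleton (μ := (volume : Measure ℝ)) c)] with s hsc
      by_cases hs : s ∈ T
      · have h1 : s ∈ Set.Ioc c 1 := ⟨lt_of_le_of_ne (csInf_le hbdd hs) (Ne.symm hsc), hs.1.2⟩
        rw [Set.indicator_of_mem hs.1, Set.indicator_of_mem h1]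
        refine mul_le_of_le_one_right' ?_
        apply Set.indicator_le_self' 
        simp
      · by_cases hs1 : s ∈ Set.Ioc (0:ℝ) 1
        · have h2 : s⁻¹ • z ∉ A - A := fun h => hs ⟨hs1, h⟩
          have h3 : (z, s) ∉ {p : EuclideanSpace ℝ (Fin (m+1)) × ℝ | p.2⁻¹ • p.1 ∈ A - A} := h2
          rw [Set.indicator_of_mem hs1, Set.indicator_of_notMem h3, mul_zero]
          exact zero_le
        · rw [Set.indicator_of_notMem hs1]; exact zero_le
    · intro s hs
      have : 0 ≤ 1 - s := by linarith [hs.2]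
      positivity


theorem compact_diff {n : ℕ} {K : Set (EuclideanSpace ℝ (Fin n))} (hK : IsCompact K) :
    IsCompact (K - K) := by
  rw [sub_eq_add_neg]
  exact hK.add hK.neg

theorem rs_conv {n : ℕ} {A : Set (EuclideanSpace ℝ (Fin n))} (ho : MeasurableSet A) :
    ∫⁻ z, volume {x | x ∈ A ∧ x - z ∈ A} = volume A * volume A := by
  have h1 : ∀ z, volume {x | x ∈ A ∧ x - z ∈ A}
      = ∫⁻ x, A.indicator (1 : EuclideanSpace ℝ (Fin n) → ENNReal) x * A.indicator (1 : EuclideanSpace ℝ (Fin n) → ENNReal) (x - z) := by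
    intro z
    have hm : MeasurableSet {x | x ∈ A ∧ x - z ∈ A} := ho.inter ((measurable_sub_const z) ho)
    rw [← lintegral_indicator_one hm]
    congr 1
    ext x
    by_cases h : x ∈ A <;> by_cases h' : x - z ∈ A <;> simp [h, h']
  have hi : Measurable (A.indicator (1 : EuclideanSpace ℝ (Fin n) → ENNReal)) :=
    measurable_one.indicator ho
  simp_rw [h1]
  rw [lintegral_lintegral_swap]
  · have : ∀ x, ∫⁻ z, A.indicator (1 : EuclideanSpace ℝ (Fin n) → ENNReal) x * A.indicator (1 : EuclideanSpace ℝ (Fin n) → ENNReal) (x - z)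
        = A.indicator (1 : EuclideanSpace ℝ (Fin n) → ENNReal) x * volume A := by
      intro x
      have hm : Measurable fun z => A.indicator (1 : EuclideanSpace ℝ (Fin n) → ENNReal) (x - z) :=
        hi.comp (measurable_const_sub x)
      rw [lintegral_const_mul _ hm,
        lintegral_sub_left_eq_self (A.indicator (1 : EuclideanSpace ℝ (Fin n) → ENNReal)) x, lintegral_indicator_one ho]
    simp_rw [this]
    rw [lintegral_mul_const _ hi, lintegral_indicator_one ho]
  · apply Measurable.aemeasurable
    exact (hi.comp measurable_snd).mul (hi.comp (measurable_snd.sub measurable_fst))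

theorem rogers_shephard_succ {m : ℕ} {A : Set (EuclideanSpace ℝ (Fin (m+1)))} (hc : Convex ℝ A)
    (ho : IsOpen A) (hA : volume A ≠ ⊤) (hne : A.Nonempty) :
    volume (A - A) ≤ ((2 * (m+1)).choose (m+1) : ENNReal) * volume A := by
  have hV0 : volume A ≠ 0 := (ho.measure_pos volume hne).ne'
  have hLo : IsOpen (A - A) := ho.sub_right
  set P := {p : EuclideanSpace ℝ (Fin (m+1)) × ℝ | p.2⁻¹ • p.1 ∈ A - A} with hP
  have hPm : MeasurableSet P := by
    have : Measurable fun p : EuclideanSpace ℝ (Fin (m+1)) × ℝ => p.2⁻¹ • p.1 :=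
      measurable_snd.inv.smul measurable_fst
    exact this hLo.measurableSet
  have hw : Measurable fun s : ℝ => ENNReal.ofReal (((m:ℝ) + 1) * (1 - s) ^ m) := by fun_prop
  have hPi : Measurable (P.indicator (1 : EuclideanSpace ℝ (Fin (m+1)) × ℝ → ENNReal)) := measurable_one.indicator hPm
  have h1 := lintegral_mono (μ := volume) (rs_pointwise hc hA)
  rw [rs_conv ho.measurableSet, lintegral_lintegral_swap] at h1
  · have h2 : ∀ s ∈ Set.Ioc (0:ℝ) 1,
        ∫⁻ z, (ENNReal.ofReal (((m:ℝ) + 1) * (1 - s) ^ m) * P.indicator 1 (z, s)) * volume A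
        = ENNReal.ofReal (((m:ℝ) + 1) * (1 - s) ^ m * s ^ (m+1)) * (volume (A - A) * volume A) := by
      intro s hs
      have hPs : Measurable fun z => P.indicator (1 : EuclideanSpace ℝ (Fin (m+1)) × ℝ → ENNReal) (z, s) :=
        hPi.comp (measurable_id.prodMk measurable_const)
      rw [lintegral_mul_const' _ _ hA, lintegral_const_mul _ hPs]
      have h3 : ∀ z, P.indicator (1 : EuclideanSpace ℝ (Fin (m+1)) × ℝ → ENNReal) (z, s)
          = (s • (A - A)).indicator (1 : EuclideanSpace ℝ (Fin (m+1)) → ENNReal) z := by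
        intro z
        by_cases h : s⁻¹ • z ∈ A - A
        · rw [Set.indicator_of_mem (by exact h),
            Set.indicator_of_mem (by rwa [Set.mem_smul_set_iff_inv_smul_mem₀ hs.1.ne'])]
          rfl
        · rw [Set.indicator_of_notMem (by exact h),
            Set.indicator_of_notMem (by rwa [Set.mem_smul_set_iff_inv_smul_mem₀ hs.1.ne'])]
      simp_rw [h3]
      rw [lintegral_indicator_one ((hLo.smul₀ hs.1.ne').measurableSet), Measure.addHaar_smul,
        finrank_euclideanSpace_fin, abs_of_nonneg (pow_nonneg hs.1.le _),
        ENNReal.ofReal_mul' (pow_nonneg hs.1.le _)]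
      ring
    rw [setLIntegral_congr_fun measurableSet_Ioc h2, lintegral_mul_const _ (by fun_prop),
      beta_const, ← mul_assoc] at h1
    have h4 := (ENNReal.mul_le_mul_iff_left hV0 hA).1 h1
    have hC : (0:ℝ) < ((2 * (m+1)).choose (m+1) : ℝ) := by
      exact_mod_cast Nat.choose_pos (by omega)
    calc volume (A - A) = ((2 * (m+1)).choose (m+1) : ENNReal) *
          (ENNReal.ofReal (1 / ((2 * (m+1)).choose (m+1) : ℝ)) * volume (A - A)) := by
          rw [← mul_assoc, ← ENNReal.ofReal_natCast, ← ENNReal.ofReal_mul hC.le,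
            mul_one_div_cancel hC.ne', ENNReal.ofReal_one, one_mul]
      _ ≤ _ := mul_le_mul_right h4 _
  · apply Measurable.aemeasurable
    exact ((hw.comp measurable_snd).mul hPi).mul_const _

theorem rogers_shephard {n : ℕ} {A : Set (EuclideanSpace ℝ (Fin n))} (hc : Convex ℝ A)
    (ho : IsOpen A) (hA : volume A ≠ ⊤) (hne : A.Nonempty) :
    volume (A - A) ≤ ((2 * n).choose n : ENNReal) * volume A := by
  cases n with
  | zero =>
    simp only [mul_zero, Nat.choose_self, Nat.cast_one, one_mul]
    apply measure_mono
    intro x _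
    obtain ⟨a, ha⟩ := hne
    rwa [Subsingleton.elim x a]
  | succ m => exact rogers_shephard_succ hc ho hA hne

theorem wills_integrable {n : ℕ} {K : Set (EuclideanSpace ℝ (Fin n))}
    (hK₁ : IsCompact K) (hK₃ : K.Nonempty) {c : ℝ} (hc : 0 < c) :
    Integrable fun x : EuclideanSpace ℝ (Fin n) => Real.exp (-c * (Metric.infDist x K) ^ 2) := by
  obtain ⟨R, hR⟩ := hK₁.isBounded.exists_norm_le
  have hg := (GaussianFourier.integrable_cexp_neg_mul_sq_norm_add (V := EuclideanSpace ℝ (Fin n))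
    (b := ((c / 2 : ℝ) : ℂ)) (by simpa using hc) 0 0).norm.const_mul (Real.exp (c * R ^ 2))
  refine hg.mono' (by have := Metric.continuous_infDist_pt K; fun_prop) (Filter.Eventually.of_forall fun x => ?_)
  simp only [Complex.norm_exp]
  rw [Real.norm_of_nonneg (Real.exp_pos _).le, ← Real.exp_add, Real.exp_le_exp]
  obtain ⟨y, hy, hxy⟩ := hK₁.exists_infDist_eq_dist hK₃ x
  have h1 : ‖x‖ ≤ Metric.infDist x K + R := by
    rw [hxy, dist_eq_norm]
    calc ‖x‖ = ‖(x - y) + y‖ := by simp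
      _ ≤ _ := (norm_add_le _ _).trans (by gcongr; exact hR y hy)
  have h0 : 0 ≤ Metric.infDist x K := Metric.infDist_nonneg
  have h2 : ‖x‖ ^ 2 ≤ 2 * Metric.infDist x K ^ 2 + 2 * R ^ 2 := by
    have : ‖x‖ ^ 2 ≤ (Metric.infDist x K + R) ^ 2 := by gcongr
    nlinarith [sq_nonneg (Metric.infDist x K - R)]
  have h3 : (-((c / 2 : ℝ) : ℂ) * (‖x‖ : ℂ) ^ 2 + 0 * ((inner ℝ (0 : EuclideanSpace ℝ (Fin n)) x : ℝ) : ℂ)).re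
      = -(c / 2) * ‖x‖ ^ 2 := by
    rw [zero_mul, add_zero]
    norm_cast
  rw [h3]
  nlinarith [mul_le_mul_of_nonneg_left h2 hc.le]

theorem level_sub {n : ℕ} {K : Set (EuclideanSpace ℝ (Fin n))}
    (hK₁ : IsCompact K) (hK₃ : K.Nonempty) (t : ℝ) :
    {z | t < Real.exp (-π * (Metric.infDist z (K - K)) ^ 2)} ⊆
      {x | t < Real.exp (-(2 * π) * (Metric.infDist x K) ^ 2)} -
      {x | t < Real.exp (-(2 * π) * (Metric.infDist x K) ^ 2)} := by
  intro z hz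
  obtain ⟨_, ⟨a, ha, b, hb, rfl⟩, hd⟩ := (compact_diff hK₁).exists_infDist_eq_dist (hK₃.sub hK₃) z
  simp only [Set.mem_ofPred_eq] at hz
  rw [hd, dist_eq_norm] at hz
  set u := z - (a - b) with hu
  have key : ∀ x y, y ∈ K → ‖x - y‖ = ‖u‖ / 2 →
      t < Real.exp (-(2 * π) * (Metric.infDist x K) ^ 2) := by
    intro x y hy hxy
    refine hz.trans_le (Real.exp_le_exp.2 ?_)
    have h1 : Metric.infDist x K ≤ ‖u‖ / 2 := by
      rw [← hxy, ← dist_eq_norm]; exact Metric.infDist_le_dist_of_mem hy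
    have h2 : Metric.infDist x K ^ 2 ≤ (‖u‖ / 2) ^ 2 := by
      gcongr; exact Metric.infDist_nonneg
    nlinarith [Real.pi_pos, mul_le_mul_of_nonneg_left h2 Real.pi_pos.le, mul_nonneg Real.pi_pos.le (sq_nonneg ‖u‖)]
  refine ⟨a + (1/2 : ℝ) • u, key _ a ha ?_, b - (1/2 : ℝ) • u, key _ b hb ?_, ?_⟩
  · rw [add_sub_cancel_left, norm_smul]; norm_num; ring
  · rw [sub_sub_cancel_left, norm_neg, norm_smul]; norm_num; ring
  · show (a + (1/2 : ℝ) • u) - (b - (1/2 : ℝ) • u) = z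
    rw [hu]; module

theorem level_convex {n : ℕ} {K : Set (EuclideanSpace ℝ (Fin n))}
    (hK₂ : Convex ℝ K) (hK₃ : K.Nonempty) {t : ℝ} (ht : 0 < t) :
    Convex ℝ {x | t < Real.exp (-(2 * π) * (Metric.infDist x K) ^ 2)} := by
  have : {x | t < Real.exp (-(2 * π) * (Metric.infDist x K) ^ 2)}
      = Metric.thickening (√(-Real.log t / (2 * π))) K := by
    ext x
    rw [Metric.mem_thickening_iff_infDist_lt hK₃, Real.lt_sqrt Metric.infDist_nonneg,
      lt_div_iff₀ (by positivity), Set.mem_ofPred_eq, ← Real.log_lt_iff_lt_exp ht]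
    constructor <;> intro h <;> linarith
  rw [this]
  exact hK₂.thickening _

theorem wills_lint {n : ℕ} {K : Set (EuclideanSpace ℝ (Fin n))}
    (hK₁ : IsCompact K) (hK₂ : Convex ℝ K) (hK₃ : K.Nonempty) :
    ∫⁻ z, ENNReal.ofReal (Real.exp (-π * (Metric.infDist z (K - K)) ^ 2)) ≤
    ((2 * n).choose n : ENNReal) *
      ∫⁻ x, ENNReal.ofReal (Real.exp (-(2 * π) * (Metric.infDist x K) ^ 2)) := by
  have hc1 := Metric.continuous_infDist_pt K
  have hc2 := Metric.continuous_infDist_pt (K - K)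
  have hI := wills_integrable hK₁ hK₃ (c := 2 * π) (by positivity)
  rw [lintegral_eq_lintegral_meas_lt _ (Filter.Eventually.of_forall fun _ => (Real.exp_pos _).le)
    (by fun_prop), lintegral_eq_lintegral_meas_lt _
    (Filter.Eventually.of_forall fun _ => (Real.exp_pos _).le) (by fun_prop),
    ← lintegral_const_mul' _ _ (ENNReal.natCast_ne_top _)]
  apply setLIntegral_mono' measurableSet_Ioi
  intro t ht
  refine (measure_mono (level_sub hK₁ hK₃ t)).trans ?_
  set A := {x | t < Real.exp (-(2 * π) * (Metric.infDist x K) ^ 2)} with hA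
  rcases A.eq_empty_or_nonempty with he | hne
  · simp [he]
  · refine rogers_shephard (level_convex hK₂ hK₃ ht) ?_ (hI.measure_gt_lt_top ht).ne hne
    exact isOpen_lt continuous_const (by fun_prop)

theorem wills_difference_body {n : ℕ} (K : Set (EuclideanSpace ℝ (Fin n)))
    (hK₁ : IsCompact K) (hK₂ : Convex ℝ K) (hK₃ : K.Nonempty) :
    wills (K - K) ≤ (((2 * n).choose n : ℝ) / (2 : ℝ) ^ ((n : ℝ) / 2)) *
      wills (Real.sqrt 2 • K) := by
  have hI := wills_integrable hK₁ hK₃ (c := 2 * π) (by positivity)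
  have hI2 := wills_integrable (compact_diff hK₁) (hK₃.sub hK₃) Real.pi_pos
  have h1 : wills (K - K) ≤ ((2 * n).choose n : ℝ) *
      ∫ x, Real.exp (-(2 * π) * (Metric.infDist x K) ^ 2) := by
    have h := wills_lint hK₁ hK₂ hK₃
    rw [← ofReal_integral_eq_lintegral_ofReal hI
        (Filter.Eventually.of_forall fun _ => (Real.exp_pos _).le),
      ← ofReal_integral_eq_lintegral_ofReal hI2
        (Filter.Eventually.of_forall fun _ => (Real.exp_pos _).le),
      ← ENNReal.ofReal_natCast, ← ENNReal.ofReal_mul (Nat.cast_nonneg _)] at h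
    refine (ENNReal.ofReal_le_ofReal_iff ?_).1 h
    exact mul_nonneg (Nat.cast_nonneg _) (integral_nonneg fun _ => (Real.exp_pos _).le)
  have h2 : ∫ x, Real.exp (-(2 * π) * (Metric.infDist x K) ^ 2)
      = ((2 : ℝ) ^ ((n : ℝ) / 2))⁻¹ * wills (Real.sqrt 2 • K) := by
    have h := Measure.integral_comp_smul (volume : Measure (EuclideanSpace ℝ (Fin n)))
      (fun x => Real.exp (-π * (Metric.infDist x (√2 • K)) ^ 2)) (√2)
    have hs : (√2 : ℝ) ≠ 0 := by positivity
    simp only [infDist_smul₀ hs, finrank_euclideanSpace_fin, smul_eq_mul] at h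
    have e : |(√2 ^ n)⁻¹| = ((2 : ℝ) ^ ((n : ℝ) / 2))⁻¹ := by
      rw [abs_of_nonneg (by positivity), Real.sqrt_eq_rpow, ← Real.rpow_mul_natCast (by norm_num)]
      congr 2; ring
    rw [e] at h
    rw [wills, ← h]
    congr 1
    ext x
    rw [Real.norm_of_nonneg (by positivity), mul_pow, Real.sq_sqrt (by norm_num)]
    congr 1; ring
  rw [h2] at h1
  rw [div_eq_mul_inv, mul_assoc]
  exact h1
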